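/- arXiv:2210.05105 — 3 statements merged into one kernel-verified Lean document; each statement's English description precedes it below -/
import Mathlib

section
/- Let A ∈ ℝ^{I×R} and B ∈ ℝ^{J×R} be such that the Hadamard product G = (AᵀA) ⊛ (BᵀB) is invertible. Then the leverage score of row (i,j) of the Khatri-Rao product A⊙B equals (A[i,:] ⊛ B[j,:]) · G⁻¹ · (A[i,:] ⊛ B[j,:])ᵀ, where A[i,:] ⊛ B[j,:] denotes the entrywise product of the two row vectors. -/
open Matrix BigOperators

/-- The Khatri-Rao product of `A ∈ ℝ^{I×R}` and `B ∈ ℝ^{J×R}`: the matrix with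
rows indexed by pairs `(i,j)` defined by `(A⊙B)[(i,j), r] = A[i,r] · B[j,r]`. -/
def kr2 {I J R : ℕ} (A : Matrix (Fin I) (Fin R) ℝ) (B : Matrix (Fin J) (Fin R) ℝ) :
    Matrix (Fin I × Fin J) (Fin R) ℝ :=
  Matrix.of fun p r => A p.1 r * B p.2 r

/-- The leverage score of row `x` of a matrix `M`:
`ℓ_x(M) = M[x,:] · (MᵀM)⁻¹ · M[x,:]ᵀ`. -/
noncomputable def levScore {n R : Type*} [Fintype n] [Fintype R] [DecidableEq R]
    (M : Matrix n R ℝ) (x : n) : ℝ :=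
  M x ⬝ᵥ (Mᵀ * M)⁻¹ *ᵥ M x

/-- The Gram matrix of a Khatri-Rao product is the Hadamard product of the Gram matrices. -/
theorem transpose_kr2_mul_kr2 {I J R : ℕ} (A : Matrix (Fin I) (Fin R) ℝ)
    (B : Matrix (Fin J) (Fin R) ℝ) :
    (kr2 A B)ᵀ * kr2 A B = (Aᵀ * A).hadamard (Bᵀ * B) := by
  ext r s
  simp only [kr2, mul_apply, hadamard_apply, transpose_apply, of_apply,
    Fintype.sum_prod_type, Finset.sum_mul_sum]
  exact Finset.sum_congr rfl fun i _ => Finset.sum_congr rfl fun j _ => by ring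

/-- If `G = (AᵀA) ⊛ (BᵀB)` is invertible, then the leverage score of row `(i,j)`
of the Khatri-Rao product `A⊙B` equals
`(A[i,:] ⊛ B[j,:]) · G⁻¹ · (A[i,:] ⊛ B[j,:])ᵀ`. -/
theorem stmt4 {I J R : ℕ} (A : Matrix (Fin I) (Fin R) ℝ) (B : Matrix (Fin J) (Fin R) ℝ)
    (hinv : IsUnit ((Aᵀ * A).hadamard (Bᵀ * B)).det) :
    ∀ (i : Fin I) (j : Fin J),
      levScore (kr2 A B) (i, j) =
        (fun r => A i r * B j r) ⬝ᵥ ((Aᵀ * A).hadamard (Bᵀ * B))⁻¹ *ᵥ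
          (fun r => A i r * B j r) := by
  intro i j
  rw [levScore, transpose_kr2_mul_kr2]
  rfl
end

section
/- Let A ∈ ℝ^{I×R} and B ∈ ℝ^{J×R} have positive definite Gram matrices AᵀA and BᵀB, and define the CP-ARLS-LEV sampling probabilities p_{(i,j)} = ℓ_i(A)·ℓ_j(B)/R². Then p is a probability distribution on [I]×[J] (its entries are nonnegative and sum to 1), and for every pair (i,j) with ℓ_{(i,j)}(A⊙B) > 0 it holds that p_{(i,j)}·R / ℓ_{(i,j)}(A⊙B) ≥ 1/R; in particular the distortion parameter β = min_{(i,j)} p_{(i,j)}·R/ℓ_{(i,j)}(A⊙B) satisfies β ≥ 1/R. -/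
open Matrix BigOperators

/-- When the Gram matrix is invertible, some `w` with `wᵀM = M[x,:]` has squared norm `ℓ_x(M)`. -/
theorem exists_vecMul_eq_row_dotProduct_self_eq_levScore {n R : Type*} [Fintype n] [Fintype R]
    [DecidableEq R] (M : Matrix n R ℝ) (h : IsUnit (Mᵀ * M).det) (x : n) :
    ∃ y : R → ℝ, (M *ᵥ y) ᵥ* M = M x ∧ (M *ᵥ y) ⬝ᵥ (M *ᵥ y) = levScore M x ∧
      M x ⬝ᵥ y = levScore M x := by
  have hrow : (M *ᵥ ((Mᵀ * M)⁻¹ *ᵥ M x)) ᵥ* M = M x := by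
    rw [← mulVec_transpose, mulVec_mulVec, mulVec_mulVec, mul_nonsing_inv _ h, one_mulVec]
  refine ⟨(Mᵀ * M)⁻¹ *ᵥ M x, hrow, ?_, rfl⟩
  rw [dotProduct_mulVec, hrow, levScore]

/-- The leverage score `ℓ_x(M)` is at most the squared norm of any `w` with `wᵀM = M[x,:]`. -/
theorem levScore_le_dotProduct_self {n R : Type*} [Fintype n] [Fintype R] [DecidableEq R]
    (M : Matrix n R ℝ) (x : n) (w : n → ℝ) (hw : w ᵥ* M = M x) :
    levScore M x ≤ w ⬝ᵥ w := by
  have hww : 0 ≤ w ⬝ᵥ w := Finset.sum_nonneg fun i _ => mul_self_nonneg (w i)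
  by_cases h : IsUnit (Mᵀ * M).det
  · obtain ⟨y, -, hzz, hy⟩ := exists_vecMul_eq_row_dotProduct_self_eq_levScore M h x
    have hwz : w ⬝ᵥ (M *ᵥ y) = levScore M x := by rw [dotProduct_mulVec, hw, hy]
    have hcs : (w ⬝ᵥ (M *ᵥ y)) ^ 2 ≤ (w ⬝ᵥ w) * ((M *ᵥ y) ⬝ᵥ (M *ᵥ y)) := by
      simpa only [dotProduct, ← sq] using Finset.sum_mul_sq_le_sq_mul_sq Finset.univ w (M *ᵥ y)
    rw [hwz, hzz] at hcs
    by_contra! hlt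
    nlinarith
  · simpa [levScore, nonsing_inv_apply_not_isUnit _ h] using hww

theorem levScore_nonneg {n R : Type*} [Fintype n] [Fintype R] [DecidableEq R]
    (M : Matrix n R ℝ) (h : IsUnit (Mᵀ * M).det) (x : n) : 0 ≤ levScore M x := by
  obtain ⟨y, -, hzz, -⟩ := exists_vecMul_eq_row_dotProduct_self_eq_levScore M h x
  rw [← hzz]
  exact Finset.sum_nonneg fun i _ => mul_self_nonneg _

theorem sum_levScore {n R : Type*} [Fintype n] [Fintype R] [DecidableEq R]
    (M : Matrix n R ℝ) (h : IsUnit (Mᵀ * M).det) :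
    ∑ x, levScore M x = Fintype.card R := by
  have htrace : ∑ x, levScore M x = (M * ((Mᵀ * M)⁻¹ * Mᵀ)).trace := rfl
  rw [htrace, trace_mul_comm, Matrix.mul_assoc, nonsing_inv_mul _ h, trace_one]

theorem levScore_kr2_le {I J R : ℕ} (A : Matrix (Fin I) (Fin R) ℝ) (B : Matrix (Fin J) (Fin R) ℝ)
    (hA : IsUnit (Aᵀ * A).det) (hB : IsUnit (Bᵀ * B).det) (x : Fin I × Fin J) :
    levScore (kr2 A B) x ≤ levScore A x.1 * levScore B x.2 := by
  obtain ⟨a, ha, haa, -⟩ := exists_vecMul_eq_row_dotProduct_self_eq_levScore A hA x.1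
  obtain ⟨b, hb, hbb, -⟩ := exists_vecMul_eq_row_dotProduct_self_eq_levScore B hB x.2
  refine (levScore_le_dotProduct_self (kr2 A B) x
    (fun q => (A *ᵥ a) q.1 * (B *ᵥ b) q.2) ?_).trans_eq ?_
  · ext r
    have hr : kr2 A B x r = A x.1 r * B x.2 r := rfl
    rw [hr, ← ha, ← hb]
    simp only [vecMul, dotProduct, Finset.sum_mul_sum, Fintype.sum_prod_type, kr2, of_apply]
    exact Finset.sum_congr rfl fun k _ => Finset.sum_congr rfl fun l _ => mul_mul_mul_comm _ _ _ _
  · rw [← haa, ← hbb]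
    simp only [dotProduct, Finset.sum_mul_sum, Fintype.sum_prod_type]
    exact Finset.sum_congr rfl fun k _ => Finset.sum_congr rfl fun l _ => mul_mul_mul_comm _ _ _ _

/-- The CP-ARLS-LEV sampling probabilities `p_{(i,j)} = ℓ_i(A)·ℓ_j(B)/R²` form a
probability distribution on `[I] × [J]`, and wherever `ℓ_{(i,j)}(A⊙B) > 0` the
ratio `p_{(i,j)}·R / ℓ_{(i,j)}(A⊙B)` is at least `1/R`; in particular the
distortion parameter `β = min_{(i,j)} p_{(i,j)}·R/ℓ_{(i,j)}(A⊙B)` is at least `1/R`. -/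
theorem stmt6 {I J R : ℕ} [NeZero I] [NeZero J] (hR : 0 < R)
    (A : Matrix (Fin I) (Fin R) ℝ) (B : Matrix (Fin J) (Fin R) ℝ)
    (hA : (Aᵀ * A).PosDef) (hB : (Bᵀ * B).PosDef)
    (p : Fin I × Fin J → ℝ)
    (hp : ∀ x : Fin I × Fin J, p x = levScore A x.1 * levScore B x.2 / R ^ 2) :
    (∀ x, 0 ≤ p x) ∧ (∑ x : Fin I × Fin J, p x = 1) ∧
    (∀ x : Fin I × Fin J, 0 < levScore (kr2 A B) x →
      p x * R / levScore (kr2 A B) x ≥ 1 / R) ∧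
    ((∀ x : Fin I × Fin J, 0 < levScore (kr2 A B) x) →
      (⨅ x : Fin I × Fin J, p x * R / levScore (kr2 A B) x) ≥ 1 / R) := by
  have hA' : IsUnit (Aᵀ * A).det := hA.det_pos.ne'.isUnit
  have hB' : IsUnit (Bᵀ * B).det := hB.det_pos.ne'.isUnit
  have hR' : (0 : ℝ) < R := Nat.cast_pos.mpr hR
  have hratio : ∀ x : Fin I × Fin J, 0 < levScore (kr2 A B) x →
      1 / (R : ℝ) ≤ p x * R / levScore (kr2 A B) x := by
    intro x hx
    have hpx : p x * R = levScore A x.1 * levScore B x.2 / R := by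
      rw [hp]
      field_simp
    rw [le_div_iff₀ hx, hpx, one_div_mul_eq_div]
    exact div_le_div_of_nonneg_right (levScore_kr2_le A B hA' hB' x) hR'.le
  refine ⟨fun x => ?_, ?_, hratio, fun h => le_ciInf fun x => hratio x (h x)⟩
  · rw [hp]
    have := levScore_nonneg A hA' x.1
    have := levScore_nonneg B hB' x.2
    positivity
  · simp only [hp]
    rw [← Finset.sum_div, Fintype.sum_prod_type, ← Finset.sum_mul_sum, sum_levScore A hA',
      sum_levScore B hB', Fintype.card_fin, ← sq, div_self (pow_ne_zero 2 hR'.ne')]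
end

section
/- Let A ∈ ℝ^{I×R} and B ∈ ℝ^{J×R} be such that G = (AᵀA) ⊛ (BᵀB), the Gram matrix of the Khatri-Rao product A⊙B, is invertible. Then for every row index i of A, the marginal of the leverage scores of A⊙B over the second index is given by ∑_{j=1}^{J} ℓ_{(i,j)}(A⊙B) = A[i,:] · (G⁻¹ ⊛ (BᵀB)) · A[i,:]ᵀ. -/
open Matrix BigOperators

/-- Marginal leverage-score formula underlying STS-CP: if
`G = (AᵀA) ⊛ (BᵀB)` (the Gram matrix of `A⊙B`) is invertible, then
`∑_j ℓ_{(i,j)}(A⊙B) = A[i,:] · (G⁻¹ ⊛ (BᵀB)) · A[i,:]ᵀ`. -/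
theorem stmt10 {I J R : ℕ} (A : Matrix (Fin I) (Fin R) ℝ) (B : Matrix (Fin J) (Fin R) ℝ)
    (hinv : IsUnit ((Aᵀ * A).hadamard (Bᵀ * B)).det) (i : Fin I) :
    ∑ j : Fin J, levScore (kr2 A B) (i, j) =
      A i ⬝ᵥ ((((Aᵀ * A).hadamard (Bᵀ * B))⁻¹).hadamard (Bᵀ * B)) *ᵥ A i := by
  simp only [levScore, transpose_kr2_mul_kr2]
  generalize ((Aᵀ * A).hadamard (Bᵀ * B))⁻¹ = H
  simp only [kr2, dotProduct, mulVec, of_apply, hadamard_apply, mul_apply, transpose_apply,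
    Finset.mul_sum, Finset.sum_mul]
  rw [Finset.sum_comm]
  refine Finset.sum_congr rfl fun r _ => ?_
  rw [Finset.sum_comm]
  exact Finset.sum_congr rfl fun s _ => Finset.sum_congr rfl fun j _ => by ring
end
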